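/- There exists β₀ > 0 such that for every β ≥ β₀ and every fixed real C ≥ 1 the following holds: setting r(h) = ⌈C·h/log h⌉, one has (log h / h²) · log π_{B_{r(h)}}(η_0 = h) → −2πβ as the integer h → ∞. In other words, π_{B_{r(h)}}(η_0 = h) = exp(−(2πβ + o(1)) h²/log h). -/

import Mathlib

open Filter Topology Classical

noncomputable section

abbrev Site : Type := ℤ × ℤ

/-- Nearest-neighbor adjacency in `ℤ²`. -/
def adjP (x y : Site) : Prop := |x.1 - y.1| + |x.2 - y.2| = 1

/-- The Discrete Gaussian Hamiltonian `H(η) = ∑_{x∼y} (η_x - η_y)²`, the sum running over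
unordered nearest-neighbor pairs (each ordered pair is counted once, whence the factor 1/2). -/
def dgH (η : Site → ℤ) : ℝ :=
  (1 / 2) * ∑' p : Site × Site, if adjP p.1 p.2 then ((η p.1 - η p.2 : ℤ) : ℝ) ^ 2 else 0

/-- Unnormalized weight of the event `A` for the DG model on `Λ` with zero boundary conditions. -/
def dgW (β : ℝ) (Λ : Finset Site) (A : (Site → ℤ) → Prop) : ℝ :=
  ∑' η : Site → ℤ, if (∀ x ∉ Λ, η x = 0) ∧ A η then Real.exp (-β * dgH η) else 0

/-- `π_Λ(A)`: probability of the event `A` under the DG measure on `Λ`. -/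
def dgProb (β : ℝ) (Λ : Finset Site) (A : (Site → ℤ) → Prop) : ℝ :=
  dgW β Λ A / dgW β Λ (fun _ => True)

/-- `ϖ_Λ(A)`: DG measure conditioned on the floor event `η ≥ 0`. -/
def dgProbFloor (β : ℝ) (Λ : Finset Site) (A : (Site → ℤ) → Prop) : ℝ :=
  dgW β Λ (fun η => A η ∧ ∀ x, 0 ≤ η x) / dgW β Λ (fun η => ∀ x, 0 ≤ η x)

/-- The box `Λ_L = {1,…,L}²`. -/
def box (L : ℕ) : Finset Site := Finset.Icc (1 : ℤ) (L : ℤ) ×ˢ Finset.Icc (1 : ℤ) (L : ℤ)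

/-- The lattice ball `B_r = {x ∈ ℤ² : |x| ≤ r}`. -/
def ball (r : ℝ) : Finset Site :=
  ((Finset.Icc (-⌈r⌉) ⌈r⌉) ×ˢ (Finset.Icc (-⌈r⌉) ⌈r⌉)).filter
    fun x => ((x.1 : ℝ) ^ 2 + (x.2 : ℝ) ^ 2 ≤ r ^ 2)


/-! ### One-dimensional sums -/

lemma sum_sym (n : ℕ) (f : ℤ → ℝ) :
    ∑ a ∈ Finset.Ico (-(n:ℤ)) n, f a = ∑ k ∈ Finset.range n, (f k + f (-(k:ℤ) - 1)) := by
  induction n with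
  | zero => simp
  | succ n ih =>
    rw [Finset.sum_range_succ, ← ih]
    have h : Finset.Ico (-((n+1:ℕ):ℤ)) ((n+1:ℕ):ℤ)
        = insert (n:ℤ) (insert (-(n:ℤ)-1) (Finset.Ico (-(n:ℤ)) n)) := by
      ext x; simp only [Finset.mem_Ico, Finset.mem_insert]; push_cast; omega
    rw [h, Finset.sum_insert, Finset.sum_insert]
    · ring
    · simp
    · simp only [Finset.mem_Ico, Finset.mem_insert]; omega

lemma sum_tel (n : ℕ) (f : ℤ → ℝ) :
    ∑ a ∈ Finset.Ico (-(n:ℤ)) n, (f (a+1) - f a) = f n - f (-n) := by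
  rw [sum_sym]
  induction n with
  | zero => simp
  | succ n ih =>
    rw [Finset.sum_range_succ, ih]
    have h1 : -(n:ℤ) - 1 + 1 = -n := by ring
    have h2 : -(n:ℤ) - 1 = -((n+1:ℕ):ℤ) := by push_cast; ring
    rw [h1, h2]; push_cast; ring

lemma sum_inv_le (n : ℕ) :
    ∑ k ∈ Finset.range n, (1:ℝ) / (k + 1) ≤ 1 + Real.log n := by
  have := harmonic_le_one_add_log n
  simpa [harmonic, one_div] using this

lemma sum_half_le (n : ℕ) (hn : 1 ≤ n) :
    ∑ k ∈ Finset.range n, (1:ℝ) / (k + 1/2) ≤ 3 + Real.log n := by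
  obtain ⟨m, rfl⟩ : ∃ m, n = m + 1 := ⟨n-1, by omega⟩
  have h := sum_inv_le (m+1)
  rw [Finset.sum_range_succ] at h
  rw [Finset.sum_range_succ']
  have : ∑ k ∈ Finset.range m, (1:ℝ) / (((k+1:ℕ):ℝ) + 1/2) ≤ ∑ k ∈ Finset.range m, (1:ℝ) / (k + 1) := by
    apply Finset.sum_le_sum; intro k _
    apply one_div_le_one_div_of_le <;> push_cast <;> linarith [Nat.cast_nonneg (α := ℝ) k]
  norm_num at this h ⊢
  have h3 : (0:ℝ) ≤ ((m:ℝ)+1)⁻¹ := by positivity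
  linarith

lemma sum_max_le (n : ℕ) (hn : 1 ≤ n) :
    ∑ k ∈ Finset.range n, (1:ℝ) / (max (k:ℝ) 1) ≤ 2 + Real.log n := by
  obtain ⟨m, rfl⟩ : ∃ m, n = m + 1 := ⟨n-1, by omega⟩
  have h := sum_inv_le (m+1)
  rw [Finset.sum_range_succ] at h
  rw [Finset.sum_range_succ']
  have : ∑ k ∈ Finset.range m, (1:ℝ) / (max ((k+1:ℕ):ℝ) 1) ≤ ∑ k ∈ Finset.range m, (1:ℝ) / (k + 1) := by
    apply Finset.sum_le_sum; intro k _
    apply one_div_le_one_div_of_le 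
    · positivity
    · push_cast; exact le_max_left _ _
  norm_num at h ⊢
  have h3 : (0:ℝ) ≤ ((m:ℝ)+1)⁻¹ := by positivity
  linarith

lemma sum_sq_aux (m : ℕ) :
    ∑ k ∈ Finset.range (m+1), (1:ℝ) / ((k:ℝ) + 1)^2 ≤ 2 - (1:ℝ) / ((m:ℝ)+1) := by
  induction m with
  | zero => norm_num
  | succ m ih =>
    rw [Finset.sum_range_succ]
    have e : (1:ℝ)/(m+1) - 1/(m+2) = 1/((m+1)*(m+2)) := by field_simp; ring
    have e2 : (1:ℝ)/((m+2))^2 ≤ 1/((m+1)*(m+2)) := by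
      apply one_div_le_one_div_of_le (by positivity); nlinarith
    have e3 : (m:ℝ)+1+1 = m+2 := by ring
    push_cast
    rw [e3]
    linarith

lemma sum_max_sq_le (n : ℕ) :
    ∑ k ∈ Finset.range n, (1:ℝ) / (max (k:ℝ) 1)^2 ≤ 3 := by
  calc _ ≤ ∑ k ∈ Finset.range (n+1+1), (1:ℝ) / (max (k:ℝ) 1)^2 :=
        Finset.sum_le_sum_of_subset_of_nonneg (by intro x; simp; omega) (fun _ _ _ => by positivity)
    _ ≤ ∑ k ∈ Finset.range (n+1), (1:ℝ) / ((k:ℝ) + 1)^2 + 1 := by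
        rw [Finset.sum_range_succ']
        apply add_le_add
        · apply Finset.sum_le_sum; intro k _
          apply one_div_le_one_div_of_le (by positivity)
          push_cast
          gcongr
          exact le_max_left _ _
        · norm_num
    _ ≤ 3 := by
        have := sum_sq_aux n
        have h3 : (0:ℝ) ≤ 1 / (n+1) := by positivity
        linarith

/-! ### The primitive -/

def G (x y : ℝ) : ℝ := (1/(2*x^2)) * (y/(x^2+y^2) + Real.arctan (y/x)/x)

lemma G_deriv (x y : ℝ) (hx : x ≠ 0) : HasDerivAt (G x) (1/(x^2+y^2)^2) y := by
  have hp : x^2+y^2 ≠ 0 := by positivity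
  have h1 : HasDerivAt (fun y : ℝ => y/(x^2+y^2)) ((1*(x^2+y^2) - y*(2*y))/(x^2+y^2)^2) y := by
    apply HasDerivAt.div (hasDerivAt_id' y) _ hp
    simpa using ((hasDerivAt_id' y).pow 2).const_add (x^2)
  have h2 : HasDerivAt (fun y : ℝ => Real.arctan (y/x)/x) (1/(1+(y/x)^2)*(1/x)/x) y :=
    (((hasDerivAt_id' y).div_const x).arctan).div_const x
  have := (h1.add h2).const_mul (1/(2*x^2))
  refine this.congr_deriv ?_
  have : 1+(y/x)^2 ≠ 0 := by positivity
  have h3 : 1+(y/x)^2 = (x^2+y^2)/x^2 := by field_simp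
  rw [h3]
  field_simp
  ring

def th (x y : ℝ) : ℝ := Real.arctan ((y+1/2)/x) - Real.arctan ((y-1/2)/x)

lemma th_sq (x y : ℝ) (hx : x ≠ 0) : th x y ^ 2 ≤ x^2 * (G x (y+1/2) - G x (y-1/2)) := by
  set c := th x y with hc
  have hd : ∀ t, HasDerivAt (fun t => x^2 * G x t - 2*c*Real.arctan (t/x) + c^2*t)
      ((x/(x^2+t^2) - c)^2) t := by
    intro t
    have hp : x^2+t^2 ≠ 0 := by positivity
    have h1 := (G_deriv x t hx).const_mul (x^2)
    have h2 := (((hasDerivAt_id' t).div_const x).arctan).const_mul (2*c)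
    have h3 := (hasDerivAt_id' t).const_mul (c^2)
    refine ((h1.sub h2).add h3).congr_deriv ?_
    have h3 : 1+(t/x)^2 = (x^2+t^2)/x^2 := by field_simp
    rw [h3]
    field_simp
    ring
  have hm : Monotone (fun t => x^2 * G x t - 2*c*Real.arctan (t/x) + c^2*t) :=
    monotone_of_deriv_nonneg (fun t => (hd t).differentiableAt)
      (fun t => by rw [(hd t).deriv]; positivity)
  have := hm (show y - 1/2 ≤ y + 1/2 by linarith)
  simp only at this
  have e : c * c = c * (Real.arctan ((y+1/2)/x) - Real.arctan ((y-1/2)/x)) := by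
    conv_lhs => rw [hc]
    rw [hc, th]
  nlinarith

lemma G_step (c : ℝ) (hc : 0 < c) (b : ℝ) (hb : 0 ≤ b) :
    1/(c^2+(b+1)^2)^2 ≤ G c (b+1) - G c b := by
  have hcont : ContinuousOn (G c) (Set.Icc b (b+1)) :=
    fun t _ => (G_deriv c t hc.ne').continuousAt.continuousWithinAt
  obtain ⟨t, ht, h⟩ := exists_hasDerivAt_eq_slope (G c) (fun y => 1/(c^2+y^2)^2)
    (show b < b+1 by linarith) hcont (fun t _ => G_deriv c t hc.ne')
  have : G c (b+1) - G c b = 1/(c^2+t^2)^2 := by rw [h]; ring_nf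
  rw [this]
  apply one_div_le_one_div_of_le
  · positivity
  · have := ht.1; have := ht.2
    have : 0 ≤ t := by linarith
    gcongr

lemma sum_inv_sq_sq (c : ℝ) (hc : 0 < c) (n : ℕ) (hn : 1 ≤ n) :
    ∑ b ∈ Finset.Ico (-(n:ℤ)) n, 1/(c^2+(b:ℝ)^2)^2 ≤ 1/c^4 + 1/(c^2*n) + Real.pi/(2*c^3) := by
  have h1 : ∑ j ∈ Finset.range n, 1/(c^2+((j:ℝ)+1)^2)^2 ≤ G c n - G c 0 := by
    calc _ ≤ ∑ j ∈ Finset.range n, (G c ((j+1:ℕ):ℝ) - G c (j:ℝ)) := by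
            apply Finset.sum_le_sum; intro j _; push_cast; exact G_step c hc j (by positivity)
      _ = _ := by rw [Finset.sum_range_sub (fun j : ℕ => G c (j:ℝ))]; simp
  have h2 : ∑ j ∈ Finset.range n, 1/(c^2+(j:ℝ)^2)^2 ≤ 1/c^4 + ∑ j ∈ Finset.range n, 1/(c^2+((j:ℝ)+1)^2)^2 := by
    have := Finset.sum_range_succ' (fun j : ℕ => 1/(c^2+(j:ℝ)^2)^2) n
    rw [Finset.sum_range_succ] at this
    have h3 : 0 ≤ 1/(c^2+(n:ℝ)^2)^2 := by positivity
    have h4 : 1/(c^2+((0:ℕ):ℝ)^2)^2 = 1/c^4 := by norm_num; ring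
    rw [h4] at this
    push_cast at this
    linarith
  have hnp : (0:ℝ) < n := by exact_mod_cast hn
  have h5 : 2 * (G c n - G c 0) ≤ 1/(c^2*n) + Real.pi/(2*c^3) := by
    have e : 2 * (G c n - G c 0) = (1/c^2) * (n/(c^2+n^2)) + Real.arctan (n/c)/c^3 := by
      simp [G]; field_simp
    rw [e]
    have a1 : (n:ℝ)/(c^2+n^2) ≤ 1/n := by
      rw [div_le_div_iff₀ (by positivity) hnp]; nlinarith [sq_nonneg c]
    have a2 : Real.arctan (n/c) ≤ Real.pi/2 := (Real.arctan_lt_pi_div_two _).le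
    have a3 : Real.arctan (n/c)/c^3 ≤ (Real.pi/2)/c^3 := by gcongr
    have a4 : (1/c^2) * ((n:ℝ)/(c^2+n^2)) ≤ (1/c^2) * (1/n) := by gcongr
    have a5 : (1/c^2) * (1/(n:ℝ)) = 1/(c^2*n) := by field_simp
    have a6 : (Real.pi/2)/c^3 = Real.pi/(2*c^3) := by field_simp
    linarith
  rw [sum_sym, Finset.sum_add_distrib]
  have h6 : ∀ k : ℕ, (((-(k:ℤ)-1 : ℤ):ℝ))^2 = ((k:ℝ)+1)^2 := by intro k; push_cast; ring
  simp only [h6, Int.cast_natCast]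
  linarith

/-! ### The lattice energy -/

def T (n : ℕ) : Finset Site := Finset.Ico (-(n:ℤ)) n ×ˢ Finset.Ico (-(n:ℤ)) n

lemma T_card (n : ℕ) : ((T n).card : ℝ) = 4 * (n:ℝ)^2 := by
  have : (T n).card = (2*n)*(2*n) := by
    simp only [T, Finset.card_product, Int.card_Ico]; congr 1 <;> omega
  rw [this]; push_cast; ring

def EN (n : ℕ) (f : Site → ℝ) : ℝ :=
  ∑ x ∈ T n, ((f (x.1+1,x.2) - f x)^2 + (f (x.1,x.2+1) - f x)^2)

lemma hasSum_dir (η : Site → ℤ)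
    (d : Site) (S : Finset Site)
    (hS : ∀ x : Site, x ∉ S → η x = 0 ∧ η (x.1+d.1, x.2+d.2) = 0) :
    HasSum (fun p : Site × Site => if p.2 = (p.1.1 + d.1, p.1.2 + d.2) then
      ((η p.1 - η p.2 : ℤ) : ℝ)^2 else 0)
      (∑ x ∈ S, ((η x - η (x.1+d.1, x.2+d.2) : ℤ) : ℝ)^2) := by
  have hinj : Function.Injective (fun x : Site => ((x, (x.1+d.1, x.2+d.2)) : Site × Site)) := by
    intro x y h; exact (Prod.ext_iff.1 h).1
  rw [← hinj.hasSum_iff]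
  · have : ∀ x ∉ S, ((η x - η (x.1+d.1, x.2+d.2) : ℤ) : ℝ)^2 = 0 := by
      intro x hx; obtain ⟨h1, h2⟩ := hS x hx; rw [h1, h2]; simp
    have h := hasSum_sum_of_ne_finset_zero (L := SummationFilter.unconditional _) this
    convert h using 2
    simp
  · rintro ⟨x, y⟩ hx
    rw [if_neg]
    intro h
    apply hx
    exact ⟨x, by simp only at h ⊢; rw [h]⟩

lemma dgH_eq (n : ℕ) (η : Site → ℤ) (hη : ∀ x : Site, η x ≠ 0 → |x.1| < n ∧ |x.2| < n) :
    dgH η = EN n (fun x => (η x : ℝ)) := by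
  have h0 : ∀ x : Site, ¬ (|x.1| < n ∧ |x.2| < n) → η x = 0 := by
    intro x hx; by_contra h; exact hx (hη x h)
  have A1 := hasSum_dir η (1,0) (T n) (by
    intro x hx
    simp only [T, Finset.mem_product, Finset.mem_Ico] at hx
    constructor <;> apply h0 <;> simp only [abs_lt] <;> omega)
  have A2 := hasSum_dir η (0,1) (T n) (by
    intro x hx
    simp only [T, Finset.mem_product, Finset.mem_Ico] at hx
    constructor <;> apply h0 <;> simp only [abs_lt] <;> omega)
  have A3 := hasSum_dir η (-1,0) ((T n).image (fun x => (x.1+1,x.2))) (by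
    intro x hx
    simp only [T, Finset.mem_image, Finset.mem_product, Finset.mem_Ico, not_exists] at hx
    have := hx (x.1-1, x.2)
    simp at this
    constructor <;> apply h0 <;> simp only [abs_lt] <;> omega)
  have A4 := hasSum_dir η (0,-1) ((T n).image (fun x => (x.1,x.2+1))) (by
    intro x hx
    simp only [T, Finset.mem_image, Finset.mem_product, Finset.mem_Ico, not_exists] at hx
    have := hx (x.1, x.2-1)
    simp at this
    constructor <;> apply h0 <;> simp only [abs_lt] <;> omega)
  rw [Finset.sum_image (by intro x _ y _ h; simp [Prod.ext_iff] at h ⊢; exact h)] at A3 A4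
  have A := (A1.add A2).add (A3.add A4)
  have e : (fun p : Site × Site => if adjP p.1 p.2 then ((η p.1 - η p.2 : ℤ) : ℝ) ^ 2 else 0)
    = fun p : Site × Site => 
     ((if p.2 = (p.1.1 + 1, p.1.2 + 0) then ((η p.1 - η p.2 : ℤ) : ℝ)^2 else 0) +
      (if p.2 = (p.1.1 + 0, p.1.2 + 1) then ((η p.1 - η p.2 : ℤ) : ℝ)^2 else 0)) +
     ((if p.2 = (p.1.1 + -1, p.1.2 + 0) then ((η p.1 - η p.2 : ℤ) : ℝ)^2 else 0) +
      (if p.2 = (p.1.1 + 0, p.1.2 + -1) then ((η p.1 - η p.2 : ℤ) : ℝ)^2 else 0)) := by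
    funext p
    obtain ⟨⟨a,b⟩,⟨c,d⟩⟩ := p
    have hadj : adjP (a,b) (c,d) ↔ |a - c| + |b - d| = 1 := Iff.rfl
    simp only [Prod.mk.injEq]
    by_cases h1 : c = a + 1 ∧ d = b + 0
    · obtain ⟨rfl, rfl⟩ := h1; rw [if_pos (hadj.2 (by simp))]; simp
    by_cases h2 : c = a + 0 ∧ d = b + 1
    · obtain ⟨rfl, rfl⟩ := h2; rw [if_pos (hadj.2 (by simp))]; simp
    by_cases h3 : c = a + -1 ∧ d = b + 0
    · obtain ⟨rfl, rfl⟩ := h3; rw [if_pos (hadj.2 (by simp))]; simp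
    by_cases h4 : c = a + 0 ∧ d = b + -1
    · obtain ⟨rfl, rfl⟩ := h4; rw [if_pos (hadj.2 (by simp))]; simp
    rw [if_neg h1, if_neg h2, if_neg h3, if_neg h4, if_neg (by
      rw [hadj]
      rcases abs_cases (a-c) with h | h <;> rcases abs_cases (b-d) with h' | h' <;> omega)]; simp
  rw [dgH, e, A.tsum_eq, EN, ← Finset.sum_add_distrib, ← Finset.sum_add_distrib,
    ← Finset.sum_add_distrib, Finset.mul_sum]
  apply Finset.sum_congr rfl
  intro x _
  simp
  ring

/-! ### The flow -/

lemma arctan_add (x y : ℝ) (hx : x ≠ 0) (hy : y ≠ 0) :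
    Real.arctan (y/x) + Real.arctan (x/y) = (SignType.sign x * SignType.sign y : ℝ) * (Real.pi/2) := by
  have e : x/y = (y/x)⁻¹ := by rw [inv_div]
  rcases lt_or_gt_of_ne hx with h1 | h1 <;> rcases lt_or_gt_of_ne hy with h2 | h2
  · rw [e, Real.arctan_inv_of_pos (div_pos_of_neg_of_neg h2 h1)]; simp [sign_neg h1, sign_neg h2]
  · rw [e, Real.arctan_inv_of_neg (div_neg_of_pos_of_neg h2 h1)]; simp [sign_neg h1, sign_pos h2]
  · rw [e, Real.arctan_inv_of_neg (div_neg_of_neg_of_pos h2 h1)]; simp [sign_pos h1, sign_neg h2]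
  · rw [e, Real.arctan_inv_of_pos (div_pos h2 h1)]; simp [sign_pos h1, sign_pos h2]

def tz (a b : ℤ) : ℝ := th ((a:ℝ) + 1/2) b

lemma half_ne (a : ℤ) : (a:ℝ) + 1/2 ≠ 0 := by
  intro h
  have : ((2*a+1 : ℤ):ℝ) = 0 := by push_cast; linarith
  have := Int.cast_eq_zero.1 this
  omega

lemma half_ne2 (a : ℤ) : (a:ℝ) - 1/2 ≠ 0 := by
  have := half_ne (a-1); intro h; apply this; push_cast; linarith

lemma sgn_diff (a : ℤ) : ((SignType.sign ((a:ℝ)+1/2) : SignType) : ℝ) - ((SignType.sign ((a:ℝ)-1/2) : SignType) : ℝ)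
    = if a = 0 then 2 else 0 := by
  split_ifs with h
  · subst h
    rw [sign_pos (by norm_num), sign_neg (by norm_num)]; norm_num
  · rcases lt_or_gt_of_ne h with h | h
    · have : (a:ℝ) ≤ -1 := by exact_mod_cast (by omega : a ≤ -1)
      rw [sign_neg (by linarith), sign_neg (by linarith)]; simp
    · have : (1:ℝ) ≤ a := by exact_mod_cast (by omega : 1 ≤ a)
      rw [sign_pos (by linarith), sign_pos (by linarith)]; simp

lemma div_tz (a b : ℤ) : (tz a b - tz (a-1) b) + (tz b a - tz (b-1) a)
    = if (a,b) = ((0,0) : Site) then 2 * Real.pi else 0 := by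
  have e : ∀ a : ℤ, (((a-1:ℤ)):ℝ) + 1/2 = a - 1/2 := by intro a; push_cast; ring
  have A1 := arctan_add _ _ (half_ne a) (half_ne b)
  have A2 := arctan_add _ _ (half_ne a) (half_ne2 b)
  have A3 := arctan_add _ _ (half_ne2 a) (half_ne b)
  have A4 := arctan_add _ _ (half_ne2 a) (half_ne2 b)
  simp only [tz, th, e]
  have := sgn_diff a
  have := sgn_diff b
  have h : (if (a,b) = ((0,0) : Site) then 2 * Real.pi else 0) 
    = (if a = 0 then 2 else 0) * (if b = 0 then 2 else 0) * (Real.pi/2) := by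
    by_cases ha : a = 0 <;> by_cases hb : b = 0 <;> simp [ha, hb]; ring
  rw [h, ← sgn_diff a, ← sgn_diff b]
  linear_combination A1 - A2 - A3 + A4

lemma parts1 (n : ℕ) (t f : ℤ → ℝ) (h1 : f n = 0) (h2 : f (-n) = 0) :
    ∑ a ∈ Finset.Ico (-(n:ℤ)) n, t a * (f (a+1) - f a)
      = - ∑ a ∈ Finset.Ico (-(n:ℤ)) n, (t a - t (a-1)) * f a := by
  have := sum_tel n (fun a => t (a-1) * f a)
  simp only [h1, h2, add_sub_cancel_right] at this
  rw [← sub_eq_zero, sub_neg_eq_add, ← Finset.sum_add_distrib]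
  rw [mul_zero, mul_zero, sub_zero] at this
  rw [← this]
  apply Finset.sum_congr rfl; intros; ring

lemma flow_id (n : ℕ) (hn : 1 ≤ n) (f : Site → ℝ)
    (hf : ∀ x : Site, f x ≠ 0 → |x.1| < n ∧ |x.2| < n) :
    ∑ x ∈ T n, (tz x.1 x.2 * (f (x.1+1,x.2) - f x) + tz x.2 x.1 * (f (x.1,x.2+1) - f x))
      = - (2 * Real.pi * f (0,0)) := by
  have h0 : ∀ x : Site, ¬ (|x.1| < n ∧ |x.2| < n) → f x = 0 := by
    intro x hx; by_contra h; exact hx (hf x h)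
  rw [Finset.sum_add_distrib]
  have e1 : ∑ x ∈ T n, tz x.1 x.2 * (f (x.1+1,x.2) - f x)
      = - ∑ x ∈ T n, (tz x.1 x.2 - tz (x.1-1) x.2) * f x := by
    rw [T, Finset.sum_product_right, Finset.sum_product_right, ← Finset.sum_neg_distrib]
    apply Finset.sum_congr rfl; intro b _
    exact parts1 n (fun a => tz a b) (fun a => f (a,b)) (h0 _ (by simp)) (h0 _ (by simp))
  have e2 : ∑ x ∈ T n, tz x.2 x.1 * (f (x.1,x.2+1) - f x)
      = - ∑ x ∈ T n, (tz x.2 x.1 - tz (x.2-1) x.1) * f x := by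
    rw [T, Finset.sum_product, Finset.sum_product, ← Finset.sum_neg_distrib]
    apply Finset.sum_congr rfl; intro a _
    exact parts1 n (fun b => tz b a) (fun b => f (a,b)) (h0 _ (by simp)) (h0 _ (by simp))
  rw [e1, e2, ← neg_add, ← Finset.sum_add_distrib]
  congr 1
  have : ∀ x ∈ T n, (tz x.1 x.2 - tz (x.1-1) x.2) * f x + (tz x.2 x.1 - tz (x.2-1) x.1) * f x
     = if x = ((0,0) : Site) then 2 * Real.pi * f (0,0) else 0 := by
    intro x _
    rw [← add_mul, div_tz]
    by_cases h : x = (0,0)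
    · subst h; simp
    · rw [if_neg h, if_neg (by simpa using h)]; simp
  rw [Finset.sum_congr rfl this, Finset.sum_ite_eq', if_pos]
  simp [T]; omega

lemma tz_row (n : ℕ) (hn : 1 ≤ n) (a : ℤ) :
    ∑ b ∈ Finset.Ico (-(n:ℤ)) n, tz a b ^ 2 ≤ Real.pi / (2 * |(a:ℝ)+1/2|) + 2 / n := by
  set x : ℝ := (a:ℝ) + 1/2 with hxd
  have hx : x ≠ 0 := half_ne a
  have hn' : (1:ℝ) ≤ n := by exact_mod_cast hn
  have h1 : ∑ b ∈ Finset.Ico (-(n:ℤ)) n, tz a b ^ 2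
      ≤ x^2 * (G x (n - 1/2) - G x (-n - 1/2)) := by
    have := sum_tel n (fun b => G x ((b:ℝ) - 1/2))
    push_cast at this
    rw [← this, Finset.mul_sum]
    apply Finset.sum_le_sum; intro b _
    have := th_sq x b hx
    have e : (b:ℝ) + 1 - 1/2 = b + 1/2 := by ring
    rw [e]; exact this
  refine h1.trans ?_
  have e : x^2 * (G x (n - 1/2) - G x (-n - 1/2)) =
     (1/2) * ((n-1/2)/(x^2+(n-1/2)^2)) + (1/2) * ((n+1/2)/(x^2+(n+1/2)^2))
     + (1/2) * (Real.arctan ((n-1/2)/x)/x) + (1/2) * (Real.arctan ((n+1/2)/x)/x) := by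
    have e1 : (-(n:ℝ) - 1/2)/x = -((n+1/2)/x) := by ring
    have e2 : (-(n:ℝ) - 1/2)^2 = (n+1/2)^2 := by ring
    have e3 : (-(n:ℝ) - 1/2) = -(n+1/2) := by ring
    rw [G, G, e1, e2, e3, Real.arctan_neg]
    field_simp
    ring
  have b1 : ∀ y : ℝ, (n:ℝ)/2 ≤ y → y/(x^2+y^2) ≤ 2/n := by
    intro y hy
    rw [div_le_div_iff₀ (by positivity) (by linarith)]
    nlinarith [sq_nonneg x]
  have b2 : ∀ y : ℝ, Real.arctan y / x ≤ Real.pi/2/|x| := by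
    intro y
    refine (le_abs_self _).trans ?_
    rw [abs_div]
    gcongr
    exact abs_le.2 ⟨(Real.neg_pi_div_two_lt_arctan _).le, (Real.arctan_lt_pi_div_two _).le⟩
  rw [e]
  have := b1 (n-1/2) (by linarith)
  have := b1 (n+1/2) (by linarith)
  have := b2 ((n-1/2)/x)
  have := b2 ((n+1/2)/x)
  have e5 : Real.pi / (2 * |x|) = Real.pi/2/|x| := by rw [div_div]
  linarith

lemma tz_total (n : ℕ) (hn : 1 ≤ n) :
    ∑ x ∈ T n, tz x.1 x.2 ^ 2 ≤ Real.pi * Real.log n + (3 * Real.pi + 4) := by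
  have hn' : (0:ℝ) < n := by exact_mod_cast hn
  rw [T, Finset.sum_product]
  refine (Finset.sum_le_sum (fun a _ => tz_row n hn a)).trans ?_
  rw [sum_sym]
  have : ∀ k ∈ Finset.range n, (Real.pi / (2 * |((k:ℤ):ℝ)+1/2|) + 2 / n
      + (Real.pi / (2 * |((-(k:ℤ)-1 : ℤ):ℝ)+1/2|) + 2 / n)) 
      = Real.pi * (1/((k:ℝ)+1/2)) + 4 / n := by
    intro k _
    have e1 : |((k:ℤ):ℝ)+1/2| = k + 1/2 := by
      rw [Int.cast_natCast, abs_of_pos (by positivity)]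
    have e2 : |((-(k:ℤ)-1 : ℤ):ℝ)+1/2| = k + 1/2 := by
      push_cast
      rw [← abs_neg, abs_of_pos] 
      · ring
      · have : (0:ℝ) ≤ k := by positivity
        linarith
    rw [e1, e2]; field_simp; ring
  rw [Finset.sum_congr rfl this, Finset.sum_add_distrib, ← Finset.mul_sum]
  have := sum_half_le n hn
  have := mul_le_mul_of_nonneg_left this Real.pi_pos.le
  have e : ∑ k ∈ Finset.range n, (4:ℝ)/n = 4 := by simp; field_simp
  rw [e]; linarith

lemma tz_total' (n : ℕ) (hn : 1 ≤ n) :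
    ∑ x ∈ T n, tz x.2 x.1 ^ 2 ≤ Real.pi * Real.log n + (3 * Real.pi + 4) := by
  have := tz_total n hn
  rw [T, Finset.sum_product] at this
  rw [T, Finset.sum_product_right]
  exact this

/-- Lower bound on the energy. -/
lemma energy_lower (n : ℕ) (hn : 1 ≤ n) (f : Site → ℝ)
    (hf : ∀ x : Site, f x ≠ 0 → |x.1| < n ∧ |x.2| < n) :
    (2 * Real.pi * f (0,0))^2 ≤ (2 * Real.pi * Real.log n + (6 * Real.pi + 8)) * EN n f := by
  have h := flow_id n hn f hf
  have E0 : 0 ≤ EN n f := Finset.sum_nonneg (fun _ _ => by positivity)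
  have hS := add_le_add (tz_total n hn) (tz_total' n hn)
  rw [← Finset.sum_add_distrib] at hS
  set S := ∑ x ∈ T n, (tz x.1 x.2 ^ 2 + tz x.2 x.1 ^ 2) with hSd
  set P := 2 * Real.pi * f (0,0)
  have quad : ∀ s : ℝ, 0 ≤ S * (s * s) + (2*P) * s + EN n f := by
    intro s
    have : S * (s*s) + (2*P)*s + EN n f = ∑ x ∈ T n, ((f (x.1+1,x.2) - f x - s * tz x.1 x.2)^2
        + (f (x.1,x.2+1) - f x - s * tz x.2 x.1)^2) := by
      have hP : P = - ∑ x ∈ T n, (tz x.1 x.2 * (f (x.1+1,x.2) - f x) + tz x.2 x.1 * (f (x.1,x.2+1) - f x)) := by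
        rw [h]; ring
      rw [hP, hSd, EN, Finset.sum_mul, ← Finset.sum_neg_distrib, Finset.mul_sum, Finset.sum_mul,
        ← Finset.sum_add_distrib, ← Finset.sum_add_distrib]
      apply Finset.sum_congr rfl; intros; ring
    rw [this]
    exact Finset.sum_nonneg (fun _ _ => by positivity)
  have := discrim_le_zero quad
  rw [discrim] at this
  have : P^2 ≤ S * EN n f := by nlinarith
  refine this.trans ?_
  apply mul_le_mul_of_nonneg_right _ E0
  linarith

/-! ### The test function -/

def LL (x : Site) : ℝ := Real.log (1 + (x.1:ℝ)^2 + (x.2:ℝ)^2)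

lemma LL_diff (k : ℕ) (b : ℤ) :
    (LL ((k:ℤ)+1, b) - LL ((k:ℤ), b))^2
      ≤ (2 * max (k:ℝ) 1 + 1)^2 * (1/((max (k:ℝ) 1)^2 + (b:ℝ)^2)^2) := by
  set c : ℝ := max (k:ℝ) 1 with hc
  have hc1 : 1 ≤ c := le_max_right _ _
  have hck : (k:ℝ) ≤ c := le_max_left _ _
  have hk : (0:ℝ) ≤ k := by positivity
  have hcc : c^2 ≤ 1 + (k:ℝ)^2 := by
    rw [hc]; rcases max_choice (k:ℝ) 1 with h | h <;> rw [h] <;> nlinarith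
  have p1 : 0 < 1 + (k:ℝ)^2 + (b:ℝ)^2 := by positivity
  have p2 : 0 < 1 + ((k:ℝ)+1)^2 + (b:ℝ)^2 := by positivity
  have e : LL ((k:ℤ)+1, b) - LL ((k:ℤ), b)
     = Real.log ((1 + ((k:ℝ)+1)^2 + (b:ℝ)^2)/(1 + (k:ℝ)^2 + (b:ℝ)^2)) := by
    rw [Real.log_div p2.ne' p1.ne']; simp [LL]
  rw [e]
  have nn : 0 ≤ Real.log ((1 + ((k:ℝ)+1)^2 + (b:ℝ)^2)/(1 + (k:ℝ)^2 + (b:ℝ)^2)) := by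
    apply Real.log_nonneg; rw [le_div_iff₀ p1]; nlinarith
  have up : Real.log ((1 + ((k:ℝ)+1)^2 + (b:ℝ)^2)/(1 + (k:ℝ)^2 + (b:ℝ)^2))
      ≤ (2*c+1) * (1/(c^2+(b:ℝ)^2)) := by
    refine (Real.log_le_sub_one_of_pos (by positivity)).trans ?_
    have : (1 + ((k:ℝ)+1)^2 + (b:ℝ)^2)/(1 + (k:ℝ)^2 + (b:ℝ)^2) - 1
      = (2*k+1) * (1/(1 + (k:ℝ)^2 + (b:ℝ)^2)) := by field_simp; ring
    rw [this]
    have : 0 < c^2 + (b:ℝ)^2 := by positivity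
    gcongr
  calc _ ≤ ((2*c+1) * (1/(c^2+(b:ℝ)^2)))^2 := by gcongr
    _ = _ := by rw [mul_pow, one_div_pow]

lemma LL_row (n : ℕ) (hn : 1 ≤ n) (k : ℕ) :
    ∑ b ∈ Finset.Ico (-(n:ℤ)) n, (LL ((k:ℤ)+1, b) - LL ((k:ℤ), b))^2
      ≤ 2 * Real.pi * (1/max (k:ℝ) 1) + (9 + 5 * Real.pi/2) * (1/(max (k:ℝ) 1)^2) + 9/n := by
  refine (Finset.sum_le_sum (fun b _ => LL_diff k b)).trans ?_
  rw [← Finset.mul_sum]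
  set c : ℝ := max (k:ℝ) 1 with hc
  have hc1 : 1 ≤ c := le_max_right _ _
  have hc0 : 0 < c := by linarith
  have hn' : (0:ℝ) < n := by exact_mod_cast hn
  have h := sum_inv_sq_sq c hc0 n hn
  have h1 : (2*c+1)^2 ≤ 4*c^2+5*c := by nlinarith
  have h2 : (2*c+1)^2 ≤ 9*c^2 := by nlinarith
  refine (mul_le_mul_of_nonneg_left h (by positivity)).trans ?_
  have a1 : (2*c+1)^2 * (1/c^4) ≤ 9*c^2*(1/c^4) := by gcongr
  have a2 : (2*c+1)^2 * (1/(c^2*n)) ≤ 9*c^2*(1/(c^2*n)) := by gcongr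
  have a3 : (2*c+1)^2 * (Real.pi/(2*c^3)) ≤ (4*c^2+5*c)*(Real.pi/(2*c^3)) := by
    have := Real.pi_pos
    gcongr
  have e1 : 9*c^2*(1/c^4) = 9 * (1/c^2) := by field_simp
  have e2 : 9*c^2*(1/(c^2*n)) = 9/n := by field_simp
  have e3 : (4*c^2+5*c)*(Real.pi/(2*c^3)) = 2*Real.pi*(1/c) + (5*Real.pi/2)*(1/c^2) := by
    field_simp
    ring
  nlinarith

def c1 : ℝ := 4 * (4 * Real.pi + 3 * (9 + 5 * Real.pi/2) + 9)

lemma LL_total (n : ℕ) (hn : 1 ≤ n) :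
    ∑ x ∈ T n, (LL (x.1+1,x.2) - LL x)^2 ≤ 4 * Real.pi * Real.log n + c1/2 := by
  have hn' : (0:ℝ) < n := by exact_mod_cast hn
  rw [T, Finset.sum_product, sum_sym]
  have sym : ∀ a b : ℤ, LL (-a, b) = LL (a,b) := by intro a b; simp [LL]
  have : ∀ k ∈ Finset.range n, (∑ b ∈ Finset.Ico (-(n:ℤ)) n, (LL ((k:ℤ)+1, b) - LL ((k:ℤ), b))^2
     + ∑ b ∈ Finset.Ico (-(n:ℤ)) n, (LL (-(k:ℤ)-1+1, b) - LL (-(k:ℤ)-1, b))^2)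
     ≤ 2 * (2 * Real.pi * (1/max (k:ℝ) 1) + (9 + 5 * Real.pi/2) * (1/(max (k:ℝ) 1)^2) + 9/n) := by
    intro k _
    have e : ∑ b ∈ Finset.Ico (-(n:ℤ)) n, (LL (-(k:ℤ)-1+1, b) - LL (-(k:ℤ)-1, b))^2
      = ∑ b ∈ Finset.Ico (-(n:ℤ)) n, (LL ((k:ℤ)+1, b) - LL ((k:ℤ), b))^2 := by
      apply Finset.sum_congr rfl; intro b _
      have e1 : -(k:ℤ)-1+1 = -k := by ring
      have e2 : -(k:ℤ)-1 = -(k+1) := by ring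
      rw [e1, e2, sym, sym]; ring
    rw [e]
    have := LL_row n hn k
    linarith
  refine (Finset.sum_le_sum this).trans ?_
  rw [← Finset.mul_sum, Finset.sum_add_distrib, Finset.sum_add_distrib, ← Finset.mul_sum,
    ← Finset.mul_sum]
  have e : ∑ k ∈ Finset.range n, (9:ℝ)/n = 9 := by simp; field_simp
  rw [e, c1]
  have pp := Real.pi_pos
  have a1 := mul_le_mul_of_nonneg_left (sum_max_le n hn) (show 0 ≤ 2*Real.pi by positivity)
  have a2 := mul_le_mul_of_nonneg_left (sum_max_sq_le n) (show 0 ≤ 9+5*Real.pi/2 by positivity)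
  linarith

lemma LL_energy (n : ℕ) (hn : 1 ≤ n) : EN n LL ≤ 8 * Real.pi * Real.log n + c1 := by
  have h1 := LL_total n hn
  have h2 : ∑ x ∈ T n, (LL (x.1,x.2+1) - LL x)^2 ≤ 4 * Real.pi * Real.log n + c1/2 := by
    rw [T, Finset.sum_product] at h1
    rw [T, Finset.sum_product_right]
    have sym : ∀ a b : ℤ, LL (a, b) = LL (b,a) := by intro a b; simp [LL]; ring_nf
    convert h1 using 5
    · exact sym _ _
    · exact sym _ _
  rw [EN, Finset.sum_add_distrib]; linarith

def phi (h r : ℕ) (x : Site) : ℝ := max 0 (h * (1 - LL x / Real.log (1 + (r:ℝ)^2)))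

def etas (h r : ℕ) (x : Site) : ℤ := ⌊phi h r x⌋

lemma etas_zero (h r : ℕ) : etas h r (0,0) = h := by
  have : phi h r (0,0) = h := by simp [phi, LL]
  rw [etas, this]; simp

lemma etas_out (h r : ℕ) (hr : 1 ≤ r) (x : Site) (hx : x ∉ ball (r:ℝ)) : etas h r x = 0 := by
  have hr' : (1:ℝ) ≤ r := by exact_mod_cast hr
  have hx2 : (r:ℝ)^2 < (x.1:ℝ)^2 + (x.2:ℝ)^2 := by
    by_contra hlt
    push Not at hlt
    apply hx
    have b1 : |(x.1:ℝ)| ≤ r := abs_le_of_sq_le_sq (by nlinarith [sq_nonneg (x.2:ℝ)]) (by linarith)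
    have b2 : |(x.2:ℝ)| ≤ r := abs_le_of_sq_le_sq (by nlinarith [sq_nonneg (x.1:ℝ)]) (by linarith)
    rw [abs_le] at b1 b2
    simp only [ball, Finset.mem_filter, Finset.mem_product, Finset.mem_Icc, Int.ceil_natCast]
    refine ⟨⟨⟨?_, ?_⟩, ⟨?_, ?_⟩⟩, hlt⟩
    · exact_mod_cast b1.1
    · exact_mod_cast b1.2
    · exact_mod_cast b2.1
    · exact_mod_cast b2.2
  have lp : 0 < Real.log (1 + (r:ℝ)^2) := Real.log_pos (by nlinarith)
  have : phi h r x = 0 := by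
    rw [phi, max_eq_left]
    apply mul_nonpos_of_nonneg_of_nonpos (by positivity)
    rw [sub_nonpos, one_le_div lp, LL]
    apply Real.log_le_log <;> nlinarith
  rw [etas, this]; simp

lemma floor_diff_sq (δ : ℝ) (hδ : 0 < δ) (a b D : ℝ) (hab : (a - b)^2 ≤ D) :
    (((⌊a⌋:ℤ):ℝ) - ((⌊b⌋:ℤ):ℝ))^2 ≤ (1+δ) * D + (1+1/δ) := by
  have e : (((⌊a⌋:ℤ):ℝ) - ((⌊b⌋:ℤ):ℝ)) = (a - b) + (Int.fract b - Int.fract a) := by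
    rw [Int.fract, Int.fract]; ring
  rw [e]
  set u := a - b
  set v := Int.fract b - Int.fract a with hv
  have hv1 : v^2 ≤ 1 := by
    have := Int.fract_nonneg a; have := Int.fract_lt_one a
    have := Int.fract_nonneg b; have := Int.fract_lt_one b
    rw [sq_le_one_iff_abs_le_one, abs_le]; constructor <;> linarith
  have key : (u+v)^2 ≤ (1+δ)*u^2 + (1+1/δ)*v^2 := by
    have : (1+δ)*u^2 + (1+1/δ)*v^2 - (u+v)^2 = (δ*u - v)^2/δ := by field_simp; ring
    have : 0 ≤ (δ*u - v)^2/δ := by positivity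
    linarith
  have : 0 < 1/δ := by positivity
  nlinarith

lemma etas_energy (h r n : ℕ) (hn : 1 ≤ n) (δ : ℝ) (hδ : 0 < δ) :
    EN n (fun x => (etas h r x : ℝ)) ≤ (1+δ) * ((h / Real.log (1+(r:ℝ)^2))^2 *
      (8 * Real.pi * Real.log n + c1)) + (1+1/δ) * (8 * (n:ℝ)^2) := by
  set l := Real.log (1+(r:ℝ)^2) with hl
  have dphi : ∀ x y : Site, (phi h r x - phi h r y)^2 ≤ (h/l)^2 * (LL x - LL y)^2 := by
    intro x y
    have h1 : |phi h r x - phi h r y| ≤ |(h/l) * (LL x - LL y)| := by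
      rw [phi, phi]
      rw [max_comm 0, max_comm 0]
      refine (abs_max_sub_max_le_abs (_ : ℝ) _ _).trans ?_
      rw [← hl, ← abs_neg]
      apply le_of_eq; congr 1; ring
    rw [← mul_pow]; exact sq_le_sq.2 h1
  have : EN n (fun x => (etas h r x : ℝ)) ≤ ∑ x ∈ T n, ((1+δ) * ((h/l)^2 *
     ((LL (x.1+1,x.2) - LL x)^2 + (LL (x.1,x.2+1) - LL x)^2)) + 2 * (1+1/δ)) := by
    apply Finset.sum_le_sum; intro x _
    have := floor_diff_sq δ hδ _ _ _ (dphi (x.1+1,x.2) x)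
    have := floor_diff_sq δ hδ _ _ _ (dphi (x.1,x.2+1) x)
    simp only [etas]
    linarith
  refine this.trans ?_
  rw [Finset.sum_add_distrib, ← Finset.mul_sum, ← Finset.mul_sum, Finset.sum_const, nsmul_eq_mul,
    T_card]
  have h2 := LL_energy n hn
  rw [EN] at h2
  have : (1+δ) * ((h / l)^2 * ∑ x ∈ T n, ((LL (x.1+1,x.2) - LL x)^2 + (LL (x.1,x.2+1) - LL x)^2))
    ≤ (1+δ) * ((h / l)^2 * (8 * Real.pi * Real.log n + c1)) := by gcongr
  linarith

/-! ### Partition function -/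

def KK (β : ℝ) : ℝ := ∑' k : ℤ, Real.exp (-β * (k:ℝ)^2)

lemma KK_summable (β : ℝ) (hβ : 0 < β) : Summable (fun k : ℤ => Real.exp (-β * (k:ℝ)^2)) := by
  have hr : Real.exp (-β) < 1 := by rw [Real.exp_lt_one_iff]; linarith
  have hg := summable_geometric_of_lt_one (Real.exp_pos (-β)).le hr
  have key : ∀ n : ℕ, Real.exp (-β * (n:ℝ)^2) ≤ Real.exp (-β)^n := by
    intro n
    rw [← Real.exp_nat_mul]
    apply Real.exp_le_exp.2
    have : (n:ℝ) ≤ (n:ℝ)^2 := by exact_mod_cast Nat.le_self_pow (by norm_num) n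
    nlinarith
  apply Summable.of_nat_of_neg
  · exact Summable.of_nonneg_of_le (fun _ => (Real.exp_pos _).le) (fun n => by simpa using key n) hg
  · exact Summable.of_nonneg_of_le (fun _ => (Real.exp_pos _).le) (fun n => by simpa using key n) hg

lemma KK_one_le (β : ℝ) (hβ : 0 < β) : 1 ≤ KK β := by
  have := (KK_summable β hβ).le_tsum 0 (fun _ _ => (Real.exp_pos _).le)
  simpa [KK] using this

def supp (Λ : Finset Site) (η : Site → ℤ) : Prop := ∀ x ∉ Λ, η x = 0

lemma part_fin (β : ℝ) (hβ : 0 < β) (n : ℕ) (Λ : Finset Site)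
    (hΛ : ∀ x ∈ Λ, |x.1| < n ∧ |x.2| < n) (S : Finset (Site → ℤ)) (hS : ∀ η ∈ S, supp Λ η) :
    ∑ η ∈ S, Real.exp (-β * dgH η) ≤ KK β ^ Λ.card := by
  have hsup : ∀ η, supp Λ η → ∀ x : Site, η x ≠ 0 → |x.1| < n ∧ |x.2| < n := by
    intro η h x hx
    apply hΛ; by_contra h'; exact hx (h x h')
  let D : (Site → ℤ) → (Λ → ℤ) := fun η x => η (x.1.1+1, x.1.2) - η x.1
  have hD : Set.InjOn D S := by
    intro η hη η' hη' he
    have s1 := hS η hη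
    have s2 := hS η' hη'
    have key : ∀ k : ℕ, ∀ x : Site, (n:ℤ) ≤ x.1 + k → η x = η' x := by
      intro k
      induction k with
      | zero =>
        intro x hx
        have : x ∉ Λ := by
          intro h; have := (hΛ x h).1; rw [abs_lt] at this; push_cast at hx; omega
        rw [s1 x this, s2 x this]
      | succ k ih =>
        intro x hx
        by_cases h : x ∈ Λ
        · have e := congrFun he ⟨x, h⟩
          simp only [D] at e
          have := ih (x.1+1, x.2) (by push_cast at hx ⊢; omega)
          omega
        · rw [s1 x h, s2 x h]
    funext x
    exact key (n - x.1).toNat x (by omega)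
  have hH : ∀ η ∈ S, Real.exp (-β * dgH η) ≤ ∏ x : Λ, Real.exp (-β * ((D η x : ℤ):ℝ)^2) := by
    intro η hη
    rw [← Real.exp_sum]
    apply Real.exp_le_exp.2
    rw [← Finset.mul_sum, neg_mul, neg_mul, neg_le_neg_iff]
    apply mul_le_mul_of_nonneg_left _ hβ.le
    rw [dgH_eq n η (hsup η (hS η hη)), EN]
    have : ∑ x : Λ, ((D η x : ℤ):ℝ)^2 = ∑ x ∈ Λ, ((η (x.1+1, x.2):ℝ) - η x)^2 := by
      rw [← Finset.sum_coe_sort Λ]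
      apply Finset.sum_congr rfl; intro x _; simp [D]
    rw [this]
    calc _ ≤ ∑ x ∈ T n, ((η (x.1+1, x.2):ℝ) - η x)^2 := by
          apply Finset.sum_le_sum_of_subset_of_nonneg
          · intro x hx
            have := hΛ x hx
            simp only [abs_lt] at this
            simp only [T, Finset.mem_product, Finset.mem_Ico]; omega
          · intros; positivity
      _ ≤ _ := by
          apply Finset.sum_le_sum; intro x _; linarith [sq_nonneg ((η (x.1, x.2 + 1):ℝ) - η x)]
  let t : Λ → Finset ℤ := fun x => S.image (fun η => D η x)
  calc _ ≤ ∑ η ∈ S, ∏ x : Λ, Real.exp (-β * ((D η x : ℤ):ℝ)^2) := Finset.sum_le_sum hH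
    _ = ∑ ζ ∈ S.image D, ∏ x : Λ, Real.exp (-β * ((ζ x : ℤ):ℝ)^2) := by
        rw [Finset.sum_image hD]
    _ ≤ ∑ ζ ∈ Fintype.piFinset t, ∏ x : Λ, Real.exp (-β * ((ζ x : ℤ):ℝ)^2) := by
        apply Finset.sum_le_sum_of_subset_of_nonneg
        · intro ζ hζ
          obtain ⟨η, hη, rfl⟩ := Finset.mem_image.1 hζ
          rw [Fintype.mem_piFinset]
          intro x; exact Finset.mem_image.2 ⟨η, hη, rfl⟩
        · intros; positivity
    _ = ∏ x : Λ, ∑ k ∈ t x, Real.exp (-β * (k:ℝ)^2) := by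
        rw [Finset.prod_univ_sum]
    _ ≤ ∏ x : Λ, KK β := by
        apply Finset.prod_le_prod
        · intros; positivity
        · intro x _
          exact (KK_summable β hβ).sum_le_tsum _ (fun _ _ => (Real.exp_pos _).le)
    _ = _ := by simp

lemma part_fin' (β : ℝ) (hβ : 0 < β) (n : ℕ) (Λ : Finset Site)
    (hΛ : ∀ x ∈ Λ, |x.1| < n ∧ |x.2| < n) (A : (Site → ℤ) → Prop) (S : Finset (Site → ℤ)) :
    ∑ η ∈ S, (if (∀ x ∉ Λ, η x = 0) ∧ A η then Real.exp (-β * dgH η) else 0) ≤ KK β ^ Λ.card := by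
  rw [← Finset.sum_filter]
  apply part_fin β hβ n Λ hΛ
  intro η hη
  exact (Finset.mem_filter.1 hη).2.1

lemma dgW_summable (β : ℝ) (hβ : 0 < β) (n : ℕ) (Λ : Finset Site)
    (hΛ : ∀ x ∈ Λ, |x.1| < n ∧ |x.2| < n) (A : (Site → ℤ) → Prop) :
    Summable (fun η : Site → ℤ => if (∀ x ∉ Λ, η x = 0) ∧ A η then Real.exp (-β * dgH η) else 0) := by
  apply summable_of_sum_le _ (part_fin' β hβ n Λ hΛ A)
  intro η; dsimp only; split_ifs <;> positivity

lemma dgW_le (β : ℝ) (hβ : 0 < β) (n : ℕ) (Λ : Finset Site)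
    (hΛ : ∀ x ∈ Λ, |x.1| < n ∧ |x.2| < n) (A : (Site → ℤ) → Prop) :
    dgW β Λ A ≤ KK β ^ Λ.card := by
  apply Real.tsum_le_of_sum_le _ (part_fin' β hβ n Λ hΛ A)
  intro η; dsimp only; split_ifs <;> positivity

lemma le_dgW (β : ℝ) (hβ : 0 < β) (n : ℕ) (Λ : Finset Site)
    (hΛ : ∀ x ∈ Λ, |x.1| < n ∧ |x.2| < n) (A : (Site → ℤ) → Prop) (η : Site → ℤ)
    (h1 : ∀ x ∉ Λ, η x = 0) (h2 : A η) :
    Real.exp (-β * dgH η) ≤ dgW β Λ A := by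
  have := (dgW_summable β hβ n Λ hΛ A).le_tsum η (fun η' _ => by split_ifs <;> positivity)
  rw [if_pos ⟨h1, h2⟩] at this
  exact this

lemma one_le_Z (β : ℝ) (hβ : 0 < β) (n : ℕ) (Λ : Finset Site)
    (hΛ : ∀ x ∈ Λ, |x.1| < n ∧ |x.2| < n) : 1 ≤ dgW β Λ (fun _ => True) := by
  have := le_dgW β hβ n Λ hΛ (fun _ => True) (fun _ => 0) (by simp) trivial
  simpa [dgH] using this

lemma dgW_upper (β δ m : ℝ) (hβ : 0 < β) (hδ : 0 < δ) (hδ1 : δ < 1) (n : ℕ) (Λ : Finset Site)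
    (hΛ : ∀ x ∈ Λ, |x.1| < n ∧ |x.2| < n) (A : (Site → ℤ) → Prop)
    (hm : ∀ η, (∀ x ∉ Λ, η x = 0) → A η → m ≤ dgH η) :
    dgW β Λ A ≤ Real.exp (-β * (1-δ) * m) * KK (β*δ) ^ Λ.card := by
  have hb : 0 < β * δ := by positivity
  refine le_trans ?_ (mul_le_mul_of_nonneg_left (dgW_le (β*δ) hb n Λ hΛ A) (Real.exp_pos _).le)
  rw [dgW, dgW, ← tsum_mul_left]
  apply (dgW_summable β hβ n Λ hΛ A).tsum_le_tsum _ ((dgW_summable (β*δ) hb n Λ hΛ A).mul_left _)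
  intro η
  split_ifs with h
  · rw [← Real.exp_add]
    apply Real.exp_le_exp.2
    have := hm η h.1 h.2
    have : β * (1-δ) * m ≤ β * (1-δ) * dgH η := by
      apply mul_le_mul_of_nonneg_left this
      have : 0 < 1 - δ := by linarith
      positivity
    nlinarith
  · simp

/-! ### Bounds on the probability -/

lemma dgball_sub (r : ℕ) : ∀ x ∈ ball (r:ℝ), |x.1| < ((r+1:ℕ):ℤ) ∧ |x.2| < ((r+1:ℕ):ℤ) := by
  intro x hx
  simp only [ball, Finset.mem_filter, Finset.mem_product, Finset.mem_Icc, Int.ceil_natCast] at hx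
  simp only [abs_lt]; push_cast; omega

lemma ball_card (r : ℕ) : ((ball (r:ℝ)).card : ℝ) ≤ 4 * ((r+1:ℕ):ℝ)^2 := by
  rw [← T_card]
  exact_mod_cast Finset.card_le_card (by
    intro x hx
    have := dgball_sub r x hx
    simp only [abs_lt] at this
    simp only [T, Finset.mem_product, Finset.mem_Ico]; omega)

lemma KK_log (β : ℝ) (hβ : 0 < β) (r : ℕ) :
    Real.log (KK β ^ (ball (r:ℝ)).card) ≤ 4 * ((r+1:ℕ):ℝ)^2 * Real.log (KK β) := by
  rw [Real.log_pow]
  exact mul_le_mul_of_nonneg_right (ball_card r) (Real.log_nonneg (KK_one_le β hβ))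

lemma prob_lower (β δ : ℝ) (hβ : 0 < β) (hδ : 0 < δ) (h r : ℕ) (hr : 1 ≤ r) :
    0 < dgProb β (ball (r:ℝ)) (fun η => η (0,0) = (h:ℤ)) ∧
    -β * ((1+δ) * ((h / Real.log (1+(r:ℝ)^2))^2 *
      (8 * Real.pi * Real.log ((r+1:ℕ):ℝ) + c1)) + (1+1/δ) * (8 * ((r+1:ℕ):ℝ)^2))
      - 4 * ((r+1:ℕ):ℝ)^2 * Real.log (KK β)
    ≤ Real.log (dgProb β (ball (r:ℝ)) (fun η => η (0,0) = (h:ℤ))) := by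
  have Z1 := one_le_Z β hβ (r+1) _ (dgball_sub r)
  have Z0 : 0 < dgW β (ball (r:ℝ)) (fun _ => True) := by linarith
  have ZK := dgW_le β hβ (r+1) _ (dgball_sub r) (fun _ => True)
  have W := le_dgW β hβ (r+1) _ (dgball_sub r) (fun η => η (0,0) = (h:ℤ)) (etas h r)
    (etas_out h r hr) (etas_zero h r)
  have W0 := (Real.exp_pos _).trans_le W
  refine ⟨div_pos W0 Z0, ?_⟩
  rw [dgProb, Real.log_div W0.ne' Z0.ne']
  have a1 := Real.log_le_log (Real.exp_pos _) W
  rw [Real.log_exp] at a1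
  have a2 := (Real.log_le_log Z0 ZK).trans (KK_log β hβ r)
  have a3 := etas_energy h r (r+1) (by omega) δ hδ
  rw [← dgH_eq (r+1) (etas h r) (by
    intro x hx; apply dgball_sub; by_contra h'; exact hx (etas_out h r hr x h'))] at a3
  have a4 := mul_le_mul_of_nonneg_left a3 hβ.le
  linarith

lemma prob_upper (β δ : ℝ) (hβ : 0 < β) (hδ : 0 < δ) (hδ1 : δ < 1) (h r : ℕ)
    (hp : 0 < dgProb β (ball (r:ℝ)) (fun η => η (0,0) = (h:ℤ))) :
    Real.log (dgProb β (ball (r:ℝ)) (fun η => η (0,0) = (h:ℤ))) ≤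
      -β * (1-δ) * ((2 * Real.pi * h)^2 / (2 * Real.pi * Real.log ((r+1:ℕ):ℝ) + (6*Real.pi+8)))
      + 4 * ((r+1:ℕ):ℝ)^2 * Real.log (KK (β*δ)) := by
  have hb : 0 < β * δ := by positivity
  have Z1 := one_le_Z β hβ (r+1) _ (dgball_sub r)
  set m := (2 * Real.pi * h)^2 / (2 * Real.pi * Real.log ((r+1:ℕ):ℝ) + (6*Real.pi+8)) with hm
  have W := dgW_upper β δ m hβ hδ hδ1 (r+1) _ (dgball_sub r) (fun η => η (0,0) = (h:ℤ)) (by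
    intro η h1 h2
    have hs : ∀ x : Site, η x ≠ 0 → |x.1| < ((r+1:ℕ):ℤ) ∧ |x.2| < ((r+1:ℕ):ℤ) := by
      intro x hx; apply dgball_sub; by_contra h'; exact hx (h1 x h')
    have := energy_lower (r+1) (by omega) (fun x => (η x : ℝ)) (fun x hx => hs x (by simpa using hx))
    rw [← dgH_eq (r+1) η hs] at this
    have l0 : 0 ≤ Real.log ((r+1:ℕ):ℝ) := Real.log_natCast_nonneg _
    have := Real.pi_pos
    rw [hm, div_le_iff₀ (by positivity)]
    simp only [h2, Int.cast_natCast] at *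
    linarith)
  have K1 := KK_one_le (β*δ) hb
  have le : dgProb β (ball (r:ℝ)) (fun η => η (0,0) = (h:ℤ)) ≤
      Real.exp (-β * (1-δ) * m) * KK (β*δ) ^ (ball (r:ℝ)).card := by
    rw [dgProb, div_le_iff₀ (by linarith)]
    refine W.trans ?_
    apply le_mul_of_one_le_right _ Z1
    positivity
  refine (Real.log_le_log hp le).trans ?_
  rw [Real.log_mul (Real.exp_pos _).ne' (by positivity), Real.log_exp]
  have := KK_log (β*δ) hb r
  linarith

/-! ### Asymptotics -/

lemma log_tendsto : Tendsto (fun h : ℕ => Real.log (h:ℝ)) atTop atTop :=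
  Real.tendsto_log_atTop.comp tendsto_natCast_atTop_atTop

lemma log_div_tendsto : Tendsto (fun h : ℕ => Real.log (h:ℝ) / h) atTop (𝓝 0) :=
  (Real.isLittleO_log_id_atTop.tendsto_div_nhds_zero).comp tendsto_natCast_atTop_atTop

lemma loglog_tendsto : Tendsto (fun h : ℕ => Real.log (Real.log (h:ℝ)) / Real.log h) atTop (𝓝 0) :=
  (Real.isLittleO_log_id_atTop.tendsto_div_nhds_zero).comp log_tendsto

lemma asy1 (u : ℕ → ℝ) (C : ℝ) (hC : 0 < C)
    (hu : Tendsto (fun h : ℕ => u h * Real.log h / h) atTop (𝓝 C)) :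
    Tendsto (fun h : ℕ => Real.log (u h) / Real.log h) atTop (𝓝 1) := by
  have h1 : Tendsto (fun h : ℕ => Real.log (u h * Real.log h / h) / Real.log h) atTop (𝓝 0) :=
    (hu.log hC.ne').div_atTop log_tendsto
  have h2 := (h1.add_const 1).sub loglog_tendsto
  simp only [zero_add, sub_zero] at h2
  refine h2.congr' ?_
  filter_upwards [hu.eventually (lt_mem_nhds hC), log_tendsto.eventually_gt_atTop 0,
    eventually_gt_atTop 0] with h q1 q2 q3
  have q3' : (0:ℝ) < h := by exact_mod_cast q3
  have hu0 : u h ≠ 0 := by rintro e; rw [e] at q1; simp at q1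
  rw [Real.log_div (by positivity) q3'.ne', Real.log_mul hu0 q2.ne']
  field_simp
  ring

lemma asy2 (u : ℕ → ℝ) (C : ℝ)
    (hu : Tendsto (fun h : ℕ => u h * Real.log h / h) atTop (𝓝 C)) :
    Tendsto (fun h : ℕ => (u h)^2 * (Real.log h / (h:ℝ)^2)) atTop (𝓝 0) := by
  have h1 := (hu.pow 2).div_atTop log_tendsto
  refine h1.congr' ?_
  filter_upwards [log_tendsto.eventually_gt_atTop 0, eventually_gt_atTop 0] with h q2 q3
  have q3' : (0:ℝ) < h := by exact_mod_cast q3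
  field_simp

def rr (C : ℝ) (h : ℕ) : ℕ := ⌈C * (h:ℝ) / Real.log h⌉₊

lemma rr_eq (C : ℝ) (hC : 1 ≤ C) (h : ℕ) :
    ((⌈C * (h : ℝ) / Real.log h⌉ : ℤ) : ℝ) = (rr C h : ℝ) := by
  have : 0 ≤ C * (h : ℝ) / Real.log h := by
    have : 0 ≤ Real.log (h:ℝ) := Real.log_natCast_nonneg _
    positivity
  rw [rr, ← natCast_ceil_eq_intCast_ceil this]

lemma rr_tendsto (C : ℝ) (hC : 1 ≤ C) :
    Tendsto (fun h : ℕ => (rr C h : ℝ) * Real.log h / h) atTop (𝓝 C) := by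
  have up : Tendsto (fun h : ℕ => C + Real.log (h:ℝ) / h) atTop (𝓝 C) := by
    simpa using log_div_tendsto.const_add C
  refine tendsto_of_tendsto_of_tendsto_of_le_of_le' tendsto_const_nhds up ?_ ?_
  · filter_upwards [log_tendsto.eventually_gt_atTop 0, eventually_gt_atTop 0] with h q2 q3
    have q3' : (0:ℝ) < h := by exact_mod_cast q3
    have := Nat.le_ceil (C * (h:ℝ) / Real.log h)
    rw [div_le_iff₀ q2] at this
    rw [le_div_iff₀ q3']; exact this
  · filter_upwards [log_tendsto.eventually_gt_atTop 0, eventually_gt_atTop 0] with h q2 q3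
    have q3' : (0:ℝ) < h := by exact_mod_cast q3
    have := (Nat.ceil_lt_add_one (show 0 ≤ C * (h:ℝ) / Real.log h by positivity)).le
    rw [div_le_iff₀ q3']
    calc _ ≤ (C * (h:ℝ) / Real.log h + 1) * Real.log h := mul_le_mul_of_nonneg_right this q2.le
      _ = _ := by field_simp

lemma nn_tendsto (C : ℝ) (hC : 1 ≤ C) :
    Tendsto (fun h : ℕ => ((rr C h + 1 : ℕ) : ℝ) * Real.log h / h) atTop (𝓝 C) := by
  have := (rr_tendsto C hC).add log_div_tendsto
  rw [add_zero] at this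
  refine this.congr ?_
  intro h; push_cast; ring

lemma upper_tendsto (β δ C : ℝ) (hC : 1 ≤ C) :
    Tendsto (fun h : ℕ => (Real.log h / (h:ℝ)^2) * (
      -β * (1-δ) * ((2 * Real.pi * h)^2 / (2 * Real.pi * Real.log ((rr C h+1:ℕ):ℝ) + (6*Real.pi+8)))
      + 4 * ((rr C h+1:ℕ):ℝ)^2 * Real.log (KK (β*δ)))) atTop (𝓝 (-β * (1-δ) * (2 * Real.pi))) := by
  have C0 : 0 < C := by linarith
  have pp := Real.pi_pos
  have a1 := asy1 _ C C0 (nn_tendsto C hC)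
  have a2 := asy2 _ C (nn_tendsto C hC)
  have a3 : Tendsto (fun h : ℕ => (6*Real.pi+8) / Real.log (h:ℝ)) atTop (𝓝 0) :=
    tendsto_const_nhds.div_atTop log_tendsto
  have a4 := ((a1.const_mul (2*Real.pi)).add a3).inv₀ (by simp [pp.ne'])
  have a5 := (a4.const_mul (-β * (1-δ) * (2*Real.pi)^2)).add
    (a2.const_mul (4 * Real.log (KK (β*δ))))
  have e : -β * (1-δ) * (2*Real.pi)^2 * (2 * Real.pi * 1 + 0)⁻¹ + 4 * Real.log (KK (β*δ)) * 0
    = -β * (1-δ) * (2 * Real.pi) := by field_simp; ring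
  rw [e] at a5
  refine a5.congr' ?_
  filter_upwards [log_tendsto.eventually_gt_atTop 0, eventually_gt_atTop 0] with h q2 q3
  have q3' : (0:ℝ) < h := by exact_mod_cast q3
  have l0 : 0 ≤ Real.log ((rr C h+1:ℕ):ℝ) := Real.log_natCast_nonneg _
  set n := ((rr C h+1:ℕ):ℝ)
  have d1 : 0 < 2 * Real.pi * Real.log n + (6*Real.pi+8) := by positivity
  have e2 : (2 * Real.pi * (Real.log n / Real.log h) + (6*Real.pi+8)/Real.log h)⁻¹
     = Real.log h / (2 * Real.pi * Real.log n + (6*Real.pi+8)) := by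
    rw [← inv_div (2 * Real.pi * Real.log n + (6*Real.pi+8))]; congr 1; ring
  rw [e2]
  field_simp
  try ring

lemma lower_tendsto (β δ C : ℝ) (hC : 1 ≤ C) :
    Tendsto (fun h : ℕ => (Real.log h / (h:ℝ)^2) * (
    -β * ((1+δ) * ((h / (2 * Real.log (rr C h:ℝ)))^2 *
      (8 * Real.pi * Real.log ((rr C h+1:ℕ):ℝ) + c1)) + (1+1/δ) * (8 * ((rr C h+1:ℕ):ℝ)^2))
      - 4 * ((rr C h+1:ℕ):ℝ)^2 * Real.log (KK β))) atTop (𝓝 (-β * (1+δ) * (2 * Real.pi))) := by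
  have C0 : 0 < C := by linarith
  have a0 := asy1 _ C C0 (rr_tendsto C hC)
  have a1 := asy1 _ C C0 (nn_tendsto C hC)
  have a2 := asy2 _ C (nn_tendsto C hC)
  have a3 : Tendsto (fun h : ℕ => c1 / Real.log (h:ℝ)) atTop (𝓝 0) :=
    tendsto_const_nhds.div_atTop log_tendsto
  have a4 := ((a1.const_mul (8*Real.pi)).add a3).mul ((a0.inv₀ one_ne_zero).pow 2)
  have a5 := (a4.const_mul (-β * (1+δ) / 4)).add
    (a2.const_mul (-β * (1+1/δ) * 8 - 4 * Real.log (KK β)))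
  have e : -β * (1+δ) / 4 * ((8 * Real.pi * 1 + 0) * (1:ℝ)⁻¹^2) +
     (-β * (1+1/δ) * 8 - 4 * Real.log (KK β)) * 0
    = -β * (1+δ) * (2 * Real.pi) := by norm_num; ring
  rw [e] at a5
  refine a5.congr' ?_
  filter_upwards [log_tendsto.eventually_gt_atTop 0, eventually_gt_atTop 0,
    a0.eventually (lt_mem_nhds zero_lt_one)] with h q2 q3 q4
  have q3' : (0:ℝ) < h := by exact_mod_cast q3
  have l0 : 0 < Real.log (rr C h:ℝ) := by
    have := mul_pos q4 q2
    rwa [div_mul_cancel₀ _ q2.ne'] at this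
  set n := ((rr C h+1:ℕ):ℝ)
  set r := (rr C h:ℝ)
  have e3 : (Real.log h / (h:ℝ)^2) * ((h / (2 * Real.log r))^2 * (8 * Real.pi * Real.log n + c1))
    = (1/4) * ((8 * Real.pi * (Real.log n / Real.log h) + c1 / Real.log h) * (Real.log r / Real.log h)⁻¹^2) := by
    field_simp
    ring
  linear_combination (β * (1+δ)) * e3
/-- Large deviation rate in a ball of radius `⌈C h / log h⌉`:
`π_{B_{r(h)}}(η_0 = h) = exp(−(2πβ + o(1)) h² / log h)`. -/
theorem dg_ball_rate :
    ∃ β₀ > (0 : ℝ), ∀ β ≥ β₀, ∀ C : ℝ, 1 ≤ C →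
      Tendsto (fun h : ℕ =>
          (Real.log h / (h : ℝ) ^ 2) *
            Real.log (dgProb β (ball ((⌈C * (h : ℝ) / Real.log h⌉ : ℤ) : ℝ))
              fun η => η (0, 0) = (h : ℤ)))
        atTop (𝓝 (-(2 * Real.pi * β))) := by
  refine ⟨1, one_pos, ?_⟩
  intro β hβ1 C hC
  have hβ : 0 < β := by linarith
  have pp := Real.pi_pos
  simp only [rr_eq C hC]
  have ev : ∀ᶠ h : ℕ in atTop, 0 < Real.log (h:ℝ) ∧ 0 < Real.log (rr C h:ℝ) := by
    have a0 := asy1 _ C (by linarith) (rr_tendsto C hC)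
    filter_upwards [log_tendsto.eventually_gt_atTop 0,
      a0.eventually (lt_mem_nhds zero_lt_one)] with h q2 q4
    refine ⟨q2, ?_⟩
    have := mul_pos q4 q2
    rwa [div_mul_cancel₀ _ q2.ne'] at this
  have hr1 : ∀ h : ℕ, 0 < Real.log (rr C h:ℝ) → 1 ≤ rr C h := by
    intro h hl
    rcases Nat.eq_zero_or_pos (rr C h) with e | e
    · rw [e] at hl; simp at hl
    · exact e
  rw [tendsto_order]
  constructor
  · intro a ha
    obtain ⟨δ, hδ, hlt⟩ : ∃ δ : ℝ, 0 < δ ∧ a < -β * (1+δ) * (2 * Real.pi) := by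
      refine ⟨(-(2*Real.pi*β) - a) / (4 * Real.pi * β), ?_, ?_⟩
      · apply div_pos <;> [linarith; positivity]
      · have : -β * (1+(-(2*Real.pi*β) - a) / (4 * Real.pi * β)) * (2 * Real.pi)
          = -(2*Real.pi*β) - (-(2*Real.pi*β) - a)/2 := by field_simp; ring
        rw [this]; linarith
    filter_upwards [(lower_tendsto β δ C hC).eventually (lt_mem_nhds hlt), ev] with h h1 h2
    refine h1.trans_le ?_
    obtain ⟨h3, h4⟩ := h2
    have r1 := hr1 h h4
    apply mul_le_mul_of_nonneg_left _ (by positivity)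
    refine le_trans ?_ (prob_lower β δ hβ hδ h (rr C h) r1).2
    have r1' : (1:ℝ) ≤ rr C h := by exact_mod_cast r1
    have l2 : 2 * Real.log (rr C h:ℝ) ≤ Real.log (1 + (rr C h:ℝ)^2) := by
      have : 2 * Real.log (rr C h:ℝ) = Real.log ((rr C h:ℝ)^2) := by rw [Real.log_pow]; norm_num
      rw [this]; apply Real.log_le_log (by positivity); linarith
    have c1p : 0 ≤ c1 := by rw [c1]; positivity
    have ln : 0 ≤ Real.log ((rr C h+1:ℕ):ℝ) := Real.log_natCast_nonneg _
    have key : (h / Real.log (1 + (rr C h:ℝ)^2))^2 * (8 * Real.pi * Real.log ((rr C h+1:ℕ):ℝ) + c1)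
       ≤ (h / (2 * Real.log (rr C h:ℝ)))^2 * (8 * Real.pi * Real.log ((rr C h+1:ℕ):ℝ) + c1) := by
      have lp : 0 < Real.log (1 + (rr C h:ℝ)^2) := by linarith
      gcongr
    have := mul_le_mul_of_nonneg_left key (show 0 ≤ β * (1+δ) by positivity)
    linarith
  · intro a ha
    obtain ⟨δ, hδ, hδ1, hlt⟩ : ∃ δ : ℝ, 0 < δ ∧ δ < 1 ∧ -β * (1-δ) * (2 * Real.pi) < a := by
      refine ⟨min (1/2) ((a + 2*Real.pi*β) / (4 * Real.pi * β)), ?_, ?_, ?_⟩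
      · apply lt_min (by norm_num)
        apply div_pos <;> [linarith; positivity]
      · exact (min_le_left _ _).trans_lt (by norm_num)
      · have h1 := min_le_right (1/2) ((a + 2*Real.pi*β) / (4 * Real.pi * β))
        rw [le_div_iff₀ (by positivity)] at h1
        linarith
    filter_upwards [(upper_tendsto β δ C hC).eventually (gt_mem_nhds hlt), ev] with h h1 h2
    refine lt_of_le_of_lt ?_ h1
    obtain ⟨h3, h4⟩ := h2
    apply mul_le_mul_of_nonneg_left _ (by positivity)
    exact prob_upper β δ hβ hδ hδ1 h (rr C h) (prob_lower β 1 hβ one_pos h (rr C h) (hr1 h h4)).1
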